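/- arXiv:1509.09115 — 7 statements merged into one kernel-verified Lean document; each statement's English description precedes it below -/
import Mathlib

section
/- Let T and A be pretriangulated categories, let α : A ⥤ T and α* : T ⥤ A be triangulated functors (additive functors commuting with the shift functors and sending distinguished triangles to distinguished triangles), and suppose given an adjunction α* ⊣ α whose counit α* ∘ α → id_A is an isomorphism. Then: (i) α is fully faithful; (ii) for every object B of T such that α*(B) is a zero object and every object A₀ of A, every morphism B → α(A₀) is zero; and (iii) for every object X of T there is a distinguished triangle X' → X → α(α*(X)) → X'⟦1⟧ in T whose second morphism is the unit of the adjunction at X and such that α*(X') is a zero object. -/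
open CategoryTheory Limits Pretriangulated

/-- If the counit of `L ⊣ R` is an isomorphism, then `L` inverts every unit morphism. -/
theorem isIso_map_unit_app_of_isIso_counit {C D : Type*} [Category C] [Category D]
    {L : C ⥤ D} {R : D ⥤ C} (adj : L ⊣ R) [IsIso adj.counit] (X : C) :
    IsIso (L.map (adj.unit.app X)) := by
  have : IsIso (L.map (adj.unit.app X) ≫ adj.counit.app (L.obj X)) := by
    rw [adj.left_triangle_components X]
    exact IsIso.id _
  exact IsIso.of_isIso_comp_right _ (adj.counit.app (L.obj X))

/-- Morphisms from an object killed by a left adjoint to the image of the right adjoint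
vanish. -/
theorem eq_zero_of_isZero_leftAdjoint_obj {C D : Type*} [Category C] [Category D]
    [HasZeroMorphisms C] {L : C ⥤ D} {R : D ⥤ C} (adj : L ⊣ R) {X : C}
    (hX : IsZero (L.obj X)) {Y : D} (f : X ⟶ R.obj Y) : f = 0 :=
  (adj.homEquiv X Y).symm.injective (hX.eq_of_src _ _)

/-- if `α* ⊣ α` is an adjunction of triangulated functors whose counit is an
isomorphism, then `α` is fully faithful, objects killed by `α*` admit no nonzero morphisms
to objects in the image of `α`, and every object `X` fits in a distinguished triangle
`X' → X → α(α*(X)) → X'⟦1⟧` with `α*(X') = 0`. -/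
theorem statement0 {A T : Type*} [Category A] [Category T]
    [HasZeroObject A] [HasZeroObject T] [Preadditive A] [Preadditive T]
    [HasShift A ℤ] [HasShift T ℤ]
    [∀ n : ℤ, (shiftFunctor A n).Additive] [∀ n : ℤ, (shiftFunctor T n).Additive]
    [Pretriangulated A] [Pretriangulated T]
    (α : A ⥤ T) (αstar : T ⥤ A) [α.Additive] [αstar.Additive]
    [α.CommShift ℤ] [αstar.CommShift ℤ] [α.IsTriangulated] [αstar.IsTriangulated]
    (adj : αstar ⊣ α) (hcounit : IsIso adj.counit) :
    α.Full ∧ α.Faithful ∧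
    (∀ (B : T), IsZero (αstar.obj B) → ∀ (A₀ : A) (f : B ⟶ α.obj A₀), f = 0) ∧
    (∀ X : T, ∃ (X' : T) (f : X' ⟶ X) (h : α.obj (αstar.obj X) ⟶ X'⟦(1 : ℤ)⟧),
      (Triangle.mk f (adj.unit.app X) h ∈ distTriang T) ∧ IsZero (αstar.obj X')) := by
  have := hcounit
  refine ⟨adj.fullyFaithfulROfIsIsoCounit.full, adj.fullyFaithfulROfIsIsoCounit.faithful,
    fun _ hB _ f => eq_zero_of_isZero_leftAdjoint_obj adj hB f, fun X => ?_⟩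
  obtain ⟨X', f, h, hT⟩ := distinguished_cocone_triangle₁ (adj.unit.app X)
  exact ⟨X', f, h, hT, Triangle.isZero₁_of_isIso₂ _ (αstar.map_distinguished _ hT)
    (isIso_map_unit_app_of_isIso_counit adj X)⟩
end

section
/- Let T and B be pretriangulated categories, let β : B ⥤ T and β^! : T ⥤ B be triangulated functors (additive functors commuting with the shift functors and sending distinguished triangles to distinguished triangles), and suppose given an adjunction β ⊣ β^! whose unit id_B → β^! ∘ β is an isomorphism. Then: (i) β is fully faithful; (ii) for every object X of T such that β^!(X) is a zero object and every object B₀ of B, every morphism β(B₀) → X is zero; and (iii) for every object X of T there is a distinguished triangle β(β^!(X)) → X → X'' → β(β^!(X))⟦1⟧ in T whose first morphism is the counit of the adjunction at X and such that β^!(X'') is a zero object. -/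
open CategoryTheory Limits Pretriangulated

/-- if `β ⊣ β^!` is an adjunction of triangulated functors whose unit is an
isomorphism, then `β` is fully faithful, objects killed by `β^!` admit no nonzero morphisms
from objects in the image of `β`, and every object `X` fits in a distinguished triangle
`β(β^!(X)) → X → X'' → β(β^!(X))⟦1⟧` with `β^!(X'') = 0`. -/
theorem statement1 {B T : Type*} [Category B] [Category T]
    [HasZeroObject B] [HasZeroObject T] [Preadditive B] [Preadditive T]
    [HasShift B ℤ] [HasShift T ℤ]
    [∀ n : ℤ, (shiftFunctor B n).Additive] [∀ n : ℤ, (shiftFunctor T n).Additive]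
    [Pretriangulated B] [Pretriangulated T]
    (β : B ⥤ T) (βshriek : T ⥤ B) [β.Additive] [βshriek.Additive]
    [β.CommShift ℤ] [βshriek.CommShift ℤ] [β.IsTriangulated] [βshriek.IsTriangulated]
    (adj : β ⊣ βshriek) (hunit : IsIso adj.unit) :
    β.Full ∧ β.Faithful ∧
    (∀ (X : T), IsZero (βshriek.obj X) → ∀ (B₀ : B) (f : β.obj B₀ ⟶ X), f = 0) ∧
    (∀ X : T, ∃ (X'' : T) (g : X ⟶ X'') (h : X'' ⟶ (β.obj (βshriek.obj X))⟦(1 : ℤ)⟧),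
      (Triangle.mk (adj.counit.app X) g h ∈ distTriang T) ∧ IsZero (βshriek.obj X'')) := by
  have hβ := adj.fullyFaithfulLOfIsIsoUnit
  have := hβ.full
  have := hβ.faithful
  refine ⟨hβ.full, hβ.faithful, fun X hX B₀ f => ?_, fun X => ?_⟩
  · exact (adj.homEquiv B₀ X).injective (hX.eq_of_tgt _ _)
  · obtain ⟨X'', g, h, hT⟩ := distinguished_cocone_triangle (adj.counit.app X)
    refine ⟨X'', g, h, hT, ?_⟩
    exact Triangle.isZero₃_of_isIso₁ _ (βshriek.map_distinguished _ hT)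
      (inferInstanceAs (IsIso (βshriek.map (adj.counit.app X))))
end

section
/- Let T be a pretriangulated category and let A and B be classes of objects of T such that B is stable under the shift X ↦ X⟦1⟧ and such that every morphism from an object of B to an object of A is zero. Suppose given distinguished triangles T_B → T → T_A → T_B⟦1⟧ and T'_B → T' → T'_A → T'_B⟦1⟧ with T_A, T'_A ∈ A and T_B, T'_B ∈ B. Then for every morphism φ : T → T' there exists a unique morphism φ_A : T_A → T'_A such that φ_A ∘ (T → T_A) = (T' → T'_A) ∘ φ. -/
open CategoryTheory Limits Pretriangulated

/-- given a semiorthogonal pair `(A, B)` of classes of objects (with `B` stable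
under the shift `⟦1⟧`) and decomposition triangles of `T₀` and `T₀'`, every morphism
`φ : T₀ ⟶ T₀'` has a unique component `φ_A : T_A ⟶ T'_A` compatible with the projections. -/
theorem statement2 {C : Type*} [Category C] [HasZeroObject C] [Preadditive C]
    [HasShift C ℤ] [∀ n : ℤ, (shiftFunctor C n).Additive] [Pretriangulated C]
    (A B : Set C)
    (hB : ∀ X ∈ B, (X⟦(1 : ℤ)⟧) ∈ B)
    (hBA : ∀ (b a : C), b ∈ B → a ∈ A → ∀ f : b ⟶ a, f = 0)
    {T₀ T₀' TA TB TA' TB' : C}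
    (f : TB ⟶ T₀) (g : T₀ ⟶ TA) (h : TA ⟶ TB⟦(1 : ℤ)⟧)
    (f' : TB' ⟶ T₀') (g' : T₀' ⟶ TA') (h' : TA' ⟶ TB'⟦(1 : ℤ)⟧)
    (hT : Triangle.mk f g h ∈ distTriang C)
    (hT' : Triangle.mk f' g' h' ∈ distTriang C)
    (hTA : TA ∈ A) (hTB : TB ∈ B) (hTA' : TA' ∈ A) (hTB' : TB' ∈ B)
    (φ : T₀ ⟶ T₀') :
    ∃! φA : TA ⟶ TA', g ≫ φA = φ ≫ g' := by
  obtain ⟨ψ, hψ⟩ : ∃ ψ : TA ⟶ TA', φ ≫ g' = g ≫ ψ :=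
    Triangle.yoneda_exact₂ _ hT (φ ≫ g') (hBA _ _ hTB hTA' _)
  refine ⟨ψ, hψ.symm, fun χ hχ => ?_⟩
  have hdiff : g ≫ (χ - ψ) = 0 := by
    rw [Preadditive.comp_sub, hχ, sub_eq_zero]
    exact hψ
  obtain ⟨ε, hε⟩ : ∃ ε : TB⟦(1 : ℤ)⟧ ⟶ TA', χ - ψ = h ≫ ε :=
    Triangle.yoneda_exact₃ _ hT (χ - ψ) hdiff
  rw [hBA _ _ (hB _ hTB) hTA' ε, comp_zero] at hε
  exact sub_eq_zero.1 hε
end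

section
/- Let T be a pretriangulated category and let A and B be classes of objects of T, each stable under the shifts X ↦ X⟦1⟧ and X ↦ X⟦-1⟧, such that every morphism from an object of B to an object of A is zero. Suppose given an object T₀ of T and two distinguished triangles T_B → T₀ → T_A → T_B⟦1⟧ and T'_B → T₀ → T'_A → T'_B⟦1⟧ with T_A, T'_A ∈ A and T_B, T'_B ∈ B. Then there exist unique isomorphisms a : T_A ≅ T'_A and b : T_B ≅ T'_B such that (id, a, b) is a morphism of triangles, i.e. a ∘ (T₀ → T_A) = (T₀ → T'_A), (T_B → T₀) = (T'_B → T₀) ∘ b, and (T'_A → T'_B⟦1⟧) ∘ a = b⟦1⟧ ∘ (T_A → T_B⟦1⟧). -/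
open CategoryTheory Limits Pretriangulated

/-- A morphism out of the third object of a distinguished triangle is determined by its
composition with the second morphism, if the shifted first object has no nonzero map to
the target. -/
lemma eq_of_mor₂_comp_eq {C : Type*} [Category C] [HasZeroObject C] [Preadditive C]
    [HasShift C ℤ] [∀ n : ℤ, (shiftFunctor C n).Additive] [Pretriangulated C]
    (T : Triangle C) (hT : T ∈ distTriang C) {X : C}
    (hX : ∀ k : T.obj₁⟦(1 : ℤ)⟧ ⟶ X, k = 0) {u v : T.obj₃ ⟶ X}
    (huv : T.mor₂ ≫ u = T.mor₂ ≫ v) : u = v := by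
  obtain ⟨k, hk⟩ := T.yoneda_exact₃ hT (u - v) (by rw [Preadditive.comp_sub, huv, sub_self])
  rwa [hX k, comp_zero, sub_eq_zero] at hk

/-- A morphism into the first object of a distinguished triangle is determined by its
composition with the first morphism, if the source has no nonzero map to the third object
shifted by `-1`. -/
lemma eq_of_comp_mor₁_eq {C : Type*} [Category C] [HasZeroObject C] [Preadditive C]
    [HasShift C ℤ] [∀ n : ℤ, (shiftFunctor C n).Additive] [Pretriangulated C]
    (T : Triangle C) (hT : T ∈ distTriang C) {X : C}
    (hX : ∀ k : X ⟶ T.obj₃⟦(-1 : ℤ)⟧, k = 0) {u v : X ⟶ T.obj₁}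
    (huv : u ≫ T.mor₁ = v ≫ T.mor₁) : u = v := by
  obtain ⟨k, hk⟩ := T.invRotate.coyoneda_exact₂ (inv_rot_of_distTriang T hT) (u - v)
    (show (u - v) ≫ T.mor₁ = 0 by rw [Preadditive.sub_comp, huv, sub_self])
  rw [show k = 0 from hX k, zero_comp] at hk
  exact sub_eq_zero.1 hk

/-- If there is no nonzero map from the first object of a distinguished triangle to the third
object of another one with the same second object, then the identity extends to a morphism
of triangles. -/
lemma exists_hom_of_obj₂_eq {C : Type*} [Category C] [HasZeroObject C] [Preadditive C]
    [HasShift C ℤ] [∀ n : ℤ, (shiftFunctor C n).Additive] [Pretriangulated C]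
    {Y X Z X' Z' : C} (f : X ⟶ Y) (g : Y ⟶ Z) (h : Z ⟶ X⟦(1 : ℤ)⟧)
    (f' : X' ⟶ Y) (g' : Y ⟶ Z') (h' : Z' ⟶ X'⟦(1 : ℤ)⟧)
    (hT : Triangle.mk f g h ∈ distTriang C) (hT' : Triangle.mk f' g' h' ∈ distTriang C)
    (hXZ : ∀ k : X ⟶ Z', k = 0) :
    ∃ (a : Z ⟶ Z') (b : X ⟶ X'),
      g ≫ a = g' ∧ f = b ≫ f' ∧ a ≫ h' = h ≫ b⟦(1 : ℤ)⟧' := by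
  obtain ⟨b, hb⟩ : ∃ b : X ⟶ X', f = b ≫ f' :=
    (Triangle.mk f' g' h').coyoneda_exact₂ hT' f (hXZ (f ≫ g'))
  obtain ⟨a, ha, ha'⟩ := complete_distinguished_triangle_morphism _ _ hT hT' b (𝟙 Y)
    (show f ≫ 𝟙 Y = b ≫ f' by rw [Category.comp_id, hb])
  exact ⟨a, b, ha.trans (Category.id_comp g'), hb, ha'.symm⟩

/-- given a semiorthogonal pair `(A, B)` of shift-stable classes of objects,
two decomposition triangles of the same object `T₀` are related by a unique pair of
isomorphisms `(a, b)` forming (together with the identity of `T₀`) a morphism of triangles. -/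
theorem statement4 {C : Type*} [Category C] [HasZeroObject C] [Preadditive C]
    [HasShift C ℤ] [∀ n : ℤ, (shiftFunctor C n).Additive] [Pretriangulated C]
    (A B : Set C)
    (hA1 : ∀ X ∈ A, (X⟦(1 : ℤ)⟧) ∈ A) (hA1' : ∀ X ∈ A, (X⟦(-1 : ℤ)⟧) ∈ A)
    (hB1 : ∀ X ∈ B, (X⟦(1 : ℤ)⟧) ∈ B) (hB1' : ∀ X ∈ B, (X⟦(-1 : ℤ)⟧) ∈ B)
    (hBA : ∀ (b a : C), b ∈ B → a ∈ A → ∀ f : b ⟶ a, f = 0)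
    {T₀ TA TB TA' TB' : C}
    (f : TB ⟶ T₀) (g : T₀ ⟶ TA) (h : TA ⟶ TB⟦(1 : ℤ)⟧)
    (f' : TB' ⟶ T₀) (g' : T₀ ⟶ TA') (h' : TA' ⟶ TB'⟦(1 : ℤ)⟧)
    (hT : Triangle.mk f g h ∈ distTriang C)
    (hT' : Triangle.mk f' g' h' ∈ distTriang C)
    (hTA : TA ∈ A) (hTB : TB ∈ B) (hTA' : TA' ∈ A) (hTB' : TB' ∈ B) :
    ∃! ab : (TA ≅ TA') × (TB ≅ TB'),
      g ≫ ab.1.hom = g' ∧ f = ab.2.hom ≫ f' ∧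
      ab.1.hom ≫ h' = h ≫ (ab.2.hom)⟦(1 : ℤ)⟧' := by
  obtain ⟨a, b, ha, hb, hab⟩ := exists_hom_of_obj₂_eq f g h f' g' h' hT hT' (hBA _ _ hTB hTA')
  obtain ⟨a', b', ha', hb', -⟩ := exists_hom_of_obj₂_eq f' g' h' f g h hT' hT (hBA _ _ hTB' hTA)
  have ext₃ {X : C} (hX : X ∈ A) {u v : TA ⟶ X} (huv : g ≫ u = g ≫ v) : u = v :=
    eq_of_mor₂_comp_eq _ hT (hBA _ _ (hB1 _ hTB) hX) huv
  have ext₃' {X : C} (hX : X ∈ A) {u v : TA' ⟶ X} (huv : g' ≫ u = g' ≫ v) : u = v :=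
    eq_of_mor₂_comp_eq _ hT' (hBA _ _ (hB1 _ hTB') hX) huv
  have ext₁ {X : C} (hX : X ∈ B) {u v : X ⟶ TB} (huv : u ≫ f = v ≫ f) : u = v :=
    eq_of_comp_mor₁_eq _ hT (hBA _ _ hX (hA1' _ hTA)) huv
  have ext₁' {X : C} (hX : X ∈ B) {u v : X ⟶ TB'} (huv : u ≫ f' = v ≫ f') : u = v :=
    eq_of_comp_mor₁_eq _ hT' (hBA _ _ hX (hA1' _ hTA')) huv
  refine ⟨⟨⟨a, a', ext₃ hTA ?_, ext₃' hTA' ?_⟩, ⟨b, b', ext₁ hTB ?_, ext₁' hTB' ?_⟩⟩,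
    ⟨ha, hb, hab⟩, ?_⟩
  · rw [← Category.assoc, ha, ha', Category.comp_id]
  · rw [← Category.assoc, ha', ha, Category.comp_id]
  · rw [Category.assoc, ← hb', ← hb, Category.id_comp]
  · rw [Category.assoc, ← hb, ← hb', Category.id_comp]
  · rintro ⟨a₂, b₂⟩ ⟨ha₂, hb₂, -⟩
    exact Prod.ext (Iso.ext (ext₃ hTA' (ha₂.trans ha.symm)))
      (Iso.ext (ext₁' hTB (hb₂.symm.trans hb)))
end

section
/- Let k be a field, let T be a k-linear pretriangulated category, let n be an integer, and let S : T ⥤ T be a functor equipped with, for every pair of objects F, G of T, a k-linear isomorphism Hom(G, S(F)) ≅ (Hom(F, G))^* onto the k-linear dual space (a Serre functor structure), and equipped with, for every object F, an isomorphism S(F) ≅ F⟦n⟧ (the Calabi–Yau property of dimension n). Let A and B be classes of objects of T such that A is stable under the shift X ↦ X⟦n⟧ and every morphism from an object of B to an object of A is zero. Then every morphism from an object of A to an object of B is zero; that is, any semiorthogonal decomposition of a Calabi–Yau category is completely orthogonal. -/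
open CategoryTheory Limits Pretriangulated

/-- if a `k`-linear pretriangulated category has a Serre functor `S` which is
isomorphic to the shift `⟦n⟧` (Calabi–Yau property), then any semiorthogonal pair `(A, B)`
with `A` stable under `⟦n⟧` is completely orthogonal: all morphisms from objects of `A`
to objects of `B` vanish. -/
theorem statement5 {k : Type*} [Field k] {C : Type*} [Category C] [Preadditive C]
    [Linear k C] [HasZeroObject C] [HasShift C ℤ]
    [∀ m : ℤ, (shiftFunctor C m).Additive] [Pretriangulated C]
    (n : ℤ) (S : C ⥤ C)
    (serre : ∀ F G : C, (G ⟶ S.obj F) ≃ₗ[k] Module.Dual k (F ⟶ G))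
    (cy : ∀ F : C, S.obj F ≅ F⟦n⟧)
    (A B : Set C)
    (hA : ∀ a ∈ A, (a⟦n⟧) ∈ A)
    (hBA : ∀ b ∈ B, ∀ a ∈ A, ∀ f : b ⟶ a, f = 0) :
    ∀ a ∈ A, ∀ b ∈ B, ∀ f : a ⟶ b, f = 0 := by
  intro a ha b hb f
  have eq_zero_of_serre (g : b ⟶ S.obj a) : g = 0 := by
    rw [← cancel_mono (cy a).hom, zero_comp]
    exact hBA b hb _ (hA a ha) _
  refine (Module.forall_dual_apply_eq_zero_iff k f).1 fun φ => ?_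
  rw [← (serre a b).apply_symm_apply φ, eq_zero_of_serre ((serre a b).symm φ), map_zero,
    LinearMap.zero_apply]
end

section
/- Let k be a field and let T be a k-linear pretriangulated category. Let E be an object of T such that the k-algebra map k → End(E), λ ↦ λ·id_E, is bijective and Hom(E, E⟦i⟧) = 0 for all integers i ≠ 0 (E is an exceptional object). Assume moreover that for every object X of T the k-vector space Hom(E, X⟦i⟧) is finite-dimensional for every integer i and vanishes for all but finitely many i. Then every object X of T fits into a distinguished triangle X_B → X → X_A → X_B⟦1⟧ in which X_B is isomorphic to a finite biproduct of shifts of E (i.e. X_B ≅ E⟦n₁⟧ ⊕ ⋯ ⊕ E⟦n_m⟧ for some integers n₁, …, n_m) and Hom(E, X_A⟦i⟧) = 0 for every integer i. This gives the semiorthogonal decomposition T = ⟨E^⊥, E⟩ determined by an exceptional object. -/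
open CategoryTheory Limits Pretriangulated

namespace CategoryTheory.Pretriangulated

theorem eq_zero_of_shift_shift {C : Type*} [Category C] [Preadditive C] [HasShift C ℤ] {E : C}
    (hE : ∀ i : ℤ, i ≠ 0 → ∀ f : E ⟶ E⟦i⟧, f = 0)
    {m n : ℤ} (h : m + n ≠ 0) (f : E ⟶ E⟦m⟧⟦n⟧) : f = 0 := by
  rw [← cancel_mono ((shiftFunctorAdd C m n).inv.app E), zero_comp]
  exact hE _ h _

variable {C : Type*} [Category C] [Preadditive C] [HasZeroObject C] [HasShift C ℤ]
  [∀ m : ℤ, (shiftFunctor C m).Additive] [Pretriangulated C]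

/-- If a morphism `f` induces bijections on `Hom(E, -⟦i⟧)` for all `i`, then its cone is right
orthogonal to `E`. -/
theorem eq_zero_of_bijective_comp_shift (E : C) {T : Triangle C} (hT : T ∈ distTriang C)
    (hsurj : ∀ (i : ℤ) (v : E ⟶ T.obj₂⟦i⟧), ∃ w : E ⟶ T.obj₁⟦i⟧, w ≫ T.mor₁⟦i⟧' = v)
    (hinj : ∀ (i : ℤ) (w : E ⟶ T.obj₁⟦i⟧), w ≫ T.mor₁⟦i⟧' = 0 → w = 0)
    (i : ℤ) (u : E ⟶ T.obj₃⟦i⟧) : u = 0 := by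
  have hTi := Triangle.shift_distinguished T hT i
  have h₃₁ : u ≫ T.mor₃⟦i⟧' = 0 := by
    let φ := (shiftFunctorAdd C 1 i).inv
    have h : (u ≫ T.mor₃⟦i⟧') ≫ φ.app T.obj₁ = 0 := by
      apply hinj
      have := φ.naturality T.mor₁
      rw [Category.assoc, ← this]
      dsimp
      rw [Category.assoc, ← Functor.map_comp_assoc, comp_distTriang_mor_zero₃₁ T hT]
      simp
    rw [← cancel_mono (φ.app T.obj₁), h, zero_comp]
  obtain ⟨v, hv⟩ := Triangle.coyoneda_exact₃ _ hTi u (by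
    change u ≫ (i.negOnePow • (T.mor₃⟦i⟧' ≫ (shiftFunctorComm C 1 i).hom.app T.obj₁)) = 0
    rw [Linear.comp_units_smul, reassoc_of% h₃₁, zero_comp, smul_zero])
  obtain ⟨w, rfl⟩ := hsurj i v
  rw [hv]
  change (w ≫ T.mor₁⟦i⟧') ≫ (i.negOnePow • T.mor₂⟦i⟧') = 0
  rw [Linear.comp_units_smul, Category.assoc, ← Functor.map_comp,
    comp_distTriang_mor_zero₁₂ T hT]
  simp

section Evaluation

variable {k : Type*} [Field k] [Linear k C] {E X : C} {S : Finset ℤ} {r : S → ℕ}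
  (b : ∀ i : S, Module.Basis (Fin (r i)) k (E ⟶ X⟦(i : ℤ)⟧))

/-- The canonical isomorphism `E ≅ E⟦-i⟧⟦i⟧`. -/
noncomputable abbrev isoShiftNegShift (E : C) (i : ℤ) : E ≅ E⟦-i⟧⟦i⟧ :=
  (shiftFunctorCompIsoId C (-i) i (neg_add_cancel i)).symm.app E

/-- The evaluation morphism to `X` from the biproduct of shifts of `E` indexed by bases of
`Hom(E, X⟦i⟧)`. -/
noncomputable def evaluation : (⨁ fun q : Σ i : S, Fin (r i) => E⟦-(q.1 : ℤ)⟧) ⟶ X :=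
  biproduct.desc fun q =>
    (shiftFunctor C (q.1 : ℤ)).preimage ((isoShiftNegShift E q.1).inv ≫ b q.1 q.2)

/-- The lift of a basis vector of `Hom(E, X⟦i⟧)` along the evaluation morphism. -/
noncomputable def evaluationLift (i : S) (j : Fin (r i)) :
    E ⟶ (⨁ fun q : Σ i : S, Fin (r i) => E⟦-(q.1 : ℤ)⟧)⟦(i : ℤ)⟧ :=
  (isoShiftNegShift E i).hom ≫
    (biproduct.ι (fun q : Σ i : S, Fin (r i) => E⟦-(q.1 : ℤ)⟧) ⟨i, j⟩)⟦(i : ℤ)⟧'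

theorem evaluationLift_comp (i : S) (j : Fin (r i)) :
    evaluationLift (E := E) i j ≫ (evaluation b)⟦(i : ℤ)⟧' = b i j := by
  rw [evaluationLift, Category.assoc, ← Functor.map_comp, evaluation, biproduct.ι_desc,
    Functor.map_preimage, Iso.hom_inv_id_assoc]

theorem sum_smul_evaluationLift_comp (i : S) (a : Fin (r i) → k) :
    (∑ j, a j • evaluationLift (E := E) i j) ≫ (evaluation b)⟦(i : ℤ)⟧' = ∑ j, a j • b i j := by
  simp only [Preadditive.sum_comp, Linear.smul_comp, evaluationLift_comp]

theorem exists_comp_evaluation_eq (hS : ∀ i ∉ S, ∀ f : E ⟶ X⟦i⟧, f = 0) (i : ℤ)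
    (v : E ⟶ X⟦i⟧) : ∃ w, w ≫ (evaluation b)⟦i⟧' = v := by
  by_cases hi : i ∈ S
  · exact ⟨_, (sum_smul_evaluationLift_comp b ⟨i, hi⟩ ((b ⟨i, hi⟩).repr v)).trans
      ((b ⟨i, hi⟩).sum_repr v)⟩
  · exact ⟨0, by rw [hS i hi v, zero_comp]⟩

theorem eq_sum_comp_shift_map_biproduct {J : Type} [Fintype J] (F : J → C) (i : ℤ)
    (w : E ⟶ (⨁ F)⟦i⟧) :
    w = ∑ q, (w ≫ (biproduct.π F q)⟦i⟧') ≫ (biproduct.ι F q)⟦i⟧' := by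
  simp only [Category.assoc, ← Preadditive.comp_sum, ← Functor.map_comp, ← Functor.map_sum]
  rw [biproduct.total, Functor.map_id, Category.comp_id]

theorem exists_eq_sum_smul_evaluationLift
    (hE1 : Function.Surjective (fun a : k => a • (𝟙 E)))
    (hE2 : ∀ i : ℤ, i ≠ 0 → ∀ f : E ⟶ E⟦i⟧, f = 0) (i : S)
    (w : E ⟶ (⨁ fun q : Σ i : S, Fin (r i) => E⟦-(q.1 : ℤ)⟧)⟦(i : ℤ)⟧) :
    ∃ a : Fin (r i) → k, w = ∑ j, a j • evaluationLift i j := by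
  let F : (Σ i : S, Fin (r i)) → C := fun q => E⟦-(q.1 : ℤ)⟧
  choose a ha using fun j : Fin (r i) =>
    hE1 ((w ≫ (biproduct.π F ⟨i, j⟩)⟦(i : ℤ)⟧') ≫ (isoShiftNegShift E i).inv)
  refine ⟨a, ?_⟩
  refine (eq_sum_comp_shift_map_biproduct F i w).trans ?_
  rw [Fintype.sum_sigma, Finset.sum_eq_single i]
  · refine Finset.sum_congr rfl fun j _ => ?_
    have h : w ≫ (biproduct.π F ⟨i, j⟩)⟦(i : ℤ)⟧' = a j • (isoShiftNegShift E i).hom := by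
      rw [← cancel_mono (isoShiftNegShift E i).inv, ← ha j, Linear.smul_comp, Iso.hom_inv_id]
    rw [h, Linear.smul_comp]
    rfl
  · intro i' _ hi'
    refine Finset.sum_eq_zero fun j _ => ?_
    rw [eq_zero_of_shift_shift hE2 (fun h => hi' (Subtype.ext (by lia)))
      (w ≫ (biproduct.π F ⟨i', j⟩)⟦(i : ℤ)⟧'), zero_comp]
  · simp

theorem eq_zero_of_comp_evaluation_eq_zero
    (hE1 : Function.Surjective (fun a : k => a • (𝟙 E)))
    (hE2 : ∀ i : ℤ, i ≠ 0 → ∀ f : E ⟶ E⟦i⟧, f = 0) (i : ℤ)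
    (w : E ⟶ (⨁ fun q : Σ i : S, Fin (r i) => E⟦-(q.1 : ℤ)⟧)⟦i⟧)
    (hw : w ≫ (evaluation b)⟦i⟧' = 0) : w = 0 := by
  by_cases hi : i ∈ S
  · obtain ⟨a, rfl⟩ := exists_eq_sum_smul_evaluationLift hE1 hE2 ⟨i, hi⟩ w
    have h := (sum_smul_evaluationLift_comp b ⟨i, hi⟩ a).symm.trans hw
    have ha := Fintype.linearIndependent_iff.1 (b ⟨i, hi⟩).linearIndependent a h
    simp [ha]
  · rw [eq_sum_comp_shift_map_biproduct _ i w]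
    refine Finset.sum_eq_zero fun q _ => ?_
    rw [eq_zero_of_shift_shift hE2 (fun h => hi ?_) (w ≫ (biproduct.π _ q)⟦i⟧'), zero_comp]
    rw [show i = q.1 by lia]
    exact q.1.2

end Evaluation

end CategoryTheory.Pretriangulated

/-- an exceptional object `E` of a `k`-linear pretriangulated category (with
suitable finiteness of `Hom(E, X⟦i⟧)`) induces a semiorthogonal decomposition
`T = ⟨E^⊥, E⟩`: every object `X` fits in a distinguished triangle `X_B → X → X_A → X_B⟦1⟧`
where `X_B` is a finite biproduct of shifts of `E` and `X_A ∈ E^⊥`. -/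
theorem statement7 {k : Type*} [Field k] {C : Type*} [Category C] [Preadditive C]
    [Linear k C] [HasZeroObject C] [HasShift C ℤ]
    [∀ m : ℤ, (shiftFunctor C m).Additive] [Pretriangulated C]
    (E : C)
    (hE1 : Function.Bijective (fun a : k => a • (𝟙 E)))
    (hE2 : ∀ i : ℤ, i ≠ 0 → ∀ f : E ⟶ E⟦i⟧, f = 0)
    (hfin : ∀ (X : C) (i : ℤ), FiniteDimensional k (E ⟶ X⟦i⟧))
    (hvan : ∀ X : C, Set.Finite {i : ℤ | ∃ f : E ⟶ X⟦i⟧, f ≠ 0}) :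
    ∀ X : C, ∃ (XB XA : C) (f : XB ⟶ X) (g : X ⟶ XA) (h : XA ⟶ XB⟦(1 : ℤ)⟧),
      (Triangle.mk f g h ∈ distTriang C) ∧
      (∃ (m : ℕ) (n : Fin m → ℤ), Nonempty (XB ≅ ⨁ (fun j : Fin m => (E⟦n j⟧)))) ∧
      (∀ (i : ℤ) (u : E ⟶ XA⟦i⟧), u = 0) := by
  intro X
  let S := (hvan X).toFinset
  have hS : ∀ i ∉ S, ∀ f : E ⟶ X⟦i⟧, f = 0 := fun i hi f => by
    by_contra hf
    exact hi ((hvan X).mem_toFinset.2 ⟨f, hf⟩)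
  let b := fun i : S => Module.finBasis k (E ⟶ X⟦(i : ℤ)⟧)
  obtain ⟨XA, g, h, hT⟩ := distinguished_cocone_triangle (evaluation b)
  let e := (Fintype.equivFin (Σ i : S, Fin (Module.finrank k (E ⟶ X⟦(i : ℤ)⟧)))).symm
  exact ⟨_, XA, evaluation b, g, h, hT,
    ⟨_, fun j => -((e j).1 : ℤ), ⟨(biproduct.reindex e _).symm⟩⟩,
    eq_zero_of_bijective_comp_shift E hT (exists_comp_evaluation_eq b hS)
      (eq_zero_of_comp_evaluation_eq_zero b hE1.surjective hE2)⟩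
end

section
/- Let k be a field and let T be a k-linear pretriangulated category. Let E₁, …, E_n be objects of T such that each E_j is exceptional (the map k → End(E_j), λ ↦ λ·id, is bijective and Hom(E_j, E_j⟦t⟧) = 0 for all t ≠ 0) and Hom(E_i, E_j⟦t⟧) = 0 for all i > j and all integers t (an exceptional collection). Assume that for every object X of T and every j the k-vector space Hom(E_j, X⟦i⟧) is finite-dimensional for every integer i and vanishes for all but finitely many i. Then every object X of T admits a chain of objects X = Y₀, Y₁, …, Y_n together with, for each 1 ≤ i ≤ n, a distinguished triangle B_i → Y_{i-1} → Y_i → B_i⟦1⟧ in which B_i is isomorphic to a finite biproduct of shifts of E_{n+1-i}, and such that Hom(E_j, Y_n⟦t⟧) = 0 for every 1 ≤ j ≤ n and every integer t. This gives the semiorthogonal decomposition T = ⟨E₁^⊥ ∩ ⋯ ∩ E_n^⊥, E₁, …, E_n⟩ determined by an exceptional collection. -/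
open CategoryTheory Limits Pretriangulated

section Exceptional

variable {C : Type*} [Category C] [Preadditive C] [HasShift C ℤ]

/-- `P` is left orthogonal to `X`: there are no nonzero morphisms from shifts of `P` to `X`. -/
def ShiftOrthogonal (P X : C) : Prop :=
  ∀ (s : ℤ) (f : P⟦s⟧ ⟶ X), f = 0

lemma ShiftOrthogonal.biproduct {ι : Type*} {P : C} {F : ι → C} [HasBiproduct F] [Finite ι]
    (h : ∀ l, ShiftOrthogonal P (F l)) : ShiftOrthogonal P (⨁ F) := fun s f => by
  refine biproduct.hom_ext _ _ fun l => ?_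
  rw [h l s (f ≫ biproduct.π F l), zero_comp]

variable [∀ m : ℤ, (shiftFunctor C m).Additive]

/-- The adjunction isomorphism between `Hom(P, X⟦-s⟧)` and `Hom(P⟦s⟧, X)`. -/
noncomputable def shiftAdj (P X : C) (s : ℤ) : (P ⟶ X⟦-s⟧) →+ (P⟦s⟧ ⟶ X) where
  toFun b := b⟦s⟧' ≫ (shiftFunctorCompIsoId C (-s) s (neg_add_cancel s)).hom.app X
  map_zero' := by simp
  map_add' b c := by simp

lemma shiftAdj_comp {P Q X : C} {s : ℤ} (f : P ⟶ Q) (b : Q ⟶ X⟦-s⟧) :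
    shiftAdj P X s (f ≫ b) = f⟦s⟧' ≫ shiftAdj Q X s b := by
  simp [shiftAdj]

lemma shiftAdj_bijective (P X : C) (s : ℤ) : Function.Bijective (shiftAdj P X s) := by
  constructor
  · intro b c h
    apply (shiftFunctor C s).map_injective
    exact (cancel_mono _).1 h
  · intro f
    obtain ⟨b, hb⟩ := (shiftFunctor C s).map_surjective
      (f ≫ (shiftFunctorCompIsoId C (-s) s (neg_add_cancel s)).inv.app X)
    refine ⟨b, ?_⟩
    change b⟦s⟧' ≫ _ = f
    rw [hb, Category.assoc, Iso.inv_hom_id_app]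
    exact Category.comp_id f

lemma ShiftOrthogonal.eq_zero {P X : C} (h : ShiftOrthogonal P X) (t : ℤ)
    (f : P ⟶ X⟦t⟧) : f = 0 := by
  obtain ⟨s, rfl⟩ : ∃ s, t = -s := ⟨-t, (neg_neg t).symm⟩
  exact (shiftAdj_bijective P X s).1 ((h s _).trans (map_zero _).symm)

lemma eq_zero_of_shift_hom_shift {P X : C} {s t : ℤ}
    (h : ∀ f : P ⟶ X⟦t - s⟧, f = 0) (f : P⟦s⟧ ⟶ X⟦t⟧) : f = 0 := by
  obtain ⟨b, rfl⟩ := (shiftAdj_bijective P (X⟦t⟧) s).2 f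
  have hb : b = 0 := by
    rw [← cancel_mono ((shiftFunctorAdd' C t (-s) (t - s) (by lia)).inv.app X), zero_comp]
    exact h _
  rw [hb, map_zero]

variable [HasZeroObject C] [Pretriangulated C]

lemma shiftOrthogonal_obj₃ {T : Triangle C} (hT : T ∈ distTriang C) {P : C}
    (hsurj : ∀ (s : ℤ) (f : P⟦s⟧ ⟶ T.obj₂), ∃ g, f = g ≫ T.mor₁)
    (hinj : ∀ (s : ℤ) (g : P⟦s⟧ ⟶ T.obj₁), g ≫ T.mor₁ = 0 → g = 0) :
    ShiftOrthogonal P T.obj₃ := fun s f => by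
  have hf : f ≫ T.mor₃ = 0 := by
    let e := (shiftFunctorAdd' C (s - 1) 1 s (by lia)).app P
    obtain ⟨g, hg⟩ := (shiftFunctor C (1 : ℤ)).map_surjective (e.inv ≫ f ≫ T.mor₃)
    have hg0 : g = 0 := by
      apply hinj
      apply (shiftFunctor C (1 : ℤ)).map_injective
      rw [Functor.map_comp, hg, Category.assoc, Category.assoc, comp_distTriang_mor_zero₃₁ T hT,
        comp_zero, comp_zero, Functor.map_zero]
    rw [← cancel_epi e.inv, ← hg, hg0, Functor.map_zero, comp_zero]
  obtain ⟨g, rfl⟩ := Triangle.coyoneda_exact₃ T hT f hf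
  obtain ⟨g', rfl⟩ := hsurj s g
  rw [Category.assoc, comp_distTriang_mor_zero₁₂ T hT, comp_zero]

variable {k : Type*} [Field k] [Linear k C]

/-- The total evaluation morphism from a finite sum of shifts of an exceptional object. -/
lemma exists_exceptional_approximation (E X : C)
    (hexc1 : Function.Bijective (fun a : k => a • (𝟙 E)))
    (hexc2 : ∀ t : ℤ, t ≠ 0 → ∀ f : E ⟶ E⟦t⟧, f = 0)
    (hfin : ∀ i : ℤ, FiniteDimensional k (E ⟶ X⟦i⟧))
    (hvan : Set.Finite {i : ℤ | ∃ f : E ⟶ X⟦i⟧, f ≠ 0}) :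
    ∃ (m : ℕ) (r : Fin m → ℤ) (f : (⨁ fun l => E⟦r l⟧) ⟶ X), ∀ s : ℤ,
      Function.Bijective (fun g : E⟦s⟧ ⟶ ⨁ fun l => E⟦r l⟧ => g ≫ f) := by
  have hS : Set.Finite {s : ℤ | ∃ f : E ⟶ X⟦-s⟧, f ≠ 0} :=
    hvan.preimage (f := fun s : ℤ => -s) neg_injective.injOn
  set S := {s : ℤ | ∃ f : E ⟶ X⟦-s⟧, f ≠ 0}
  have : Fintype S := hS.fintype
  let ι := Σ s : S, Fin (Module.finrank k (E ⟶ X⟦-s.1⟧))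
  let b (s : ℤ) := Module.finBasis k (E ⟶ X⟦-s⟧)
  let F : ι → C := fun l => E⟦l.1.1⟧
  let β : ∀ l : ι, F l ⟶ X := fun l => shiftAdj E X l.1.1 (b l.1.1 l.2)
  have hβ (s : S) (c : Fin (Module.finrank k (E ⟶ X⟦-s.1⟧)) → k) :
      ∑ a, (shiftFunctor C s.1).map (c a • 𝟙 E) ≫ β ⟨s, a⟩ =
        shiftAdj E X s.1 (∑ a, c a • b s.1 a) := by
    rw [map_sum]
    refine Finset.sum_congr rfl fun a _ => ?_
    rw [← shiftAdj_comp, Linear.smul_comp, Category.id_comp]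
  have hbij (s : ℤ) : Function.Bijective
      (fun g : E⟦s⟧ ⟶ ⨁ F => g ≫ biproduct.desc β) := by
    constructor
    · refine (injective_iff_map_eq_zero
        (AddMonoidHom.mk' (fun g : E⟦s⟧ ⟶ ⨁ F => g ≫ biproduct.desc β) (by simp))).2 ?_
      intro g hg
      replace hg : g ≫ biproduct.desc β = 0 := hg
      have hne (l : ι) (hl : l.1.1 ≠ s) : g ≫ biproduct.π F l = 0 :=
        eq_zero_of_shift_hom_shift (hexc2 _ (sub_ne_zero.2 hl)) _
      refine biproduct.hom_ext _ _ fun l => ?_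
      rw [zero_comp]
      by_cases hl : l.1.1 = s
      swap
      · exact hne l hl
      subst hl
      obtain ⟨s, a⟩ := l
      have hc (a) : ∃ c : k, (shiftFunctor C s.1).map (c • 𝟙 E) = g ≫ biproduct.π F ⟨s, a⟩ := by
        obtain ⟨φ, hφ⟩ := (shiftFunctor C s.1).map_surjective (g ≫ biproduct.π F ⟨s, a⟩)
        obtain ⟨c, rfl⟩ := hexc1.2 φ
        exact ⟨c, hφ⟩
      choose c hc using hc
      have hsum : g ≫ biproduct.desc β = shiftAdj E X s.1 (∑ a, c a • b s.1 a) := by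
        rw [← hβ, biproduct.desc_eq, Preadditive.comp_sum, Fintype.sum_sigma,
          Finset.sum_eq_single s]
        · exact Finset.sum_congr rfl fun a _ => by rw [hc, Category.assoc]
        · intro s' _ hs'
          refine Finset.sum_eq_zero fun a _ => ?_
          rw [← Category.assoc, hne ⟨s', a⟩ (fun h => hs' (Subtype.ext h)), zero_comp]
        · simp
      have h0 := (shiftAdj_bijective E X s.1).1 ((hsum.symm.trans hg).trans (map_zero _).symm)
      have hc0 := Fintype.linearIndependent_iff.1 (b s.1).linearIndependent c h0 a
      rw [← hc a, hc0, zero_smul, Functor.map_zero]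
    · intro f
      obtain ⟨φ, rfl⟩ := (shiftAdj_bijective E X s).2 f
      by_cases hs : s ∈ S
      · refine ⟨∑ a, (shiftFunctor C s).map ((b s).repr φ a • 𝟙 E) ≫
          biproduct.ι F ⟨⟨s, hs⟩, a⟩, ?_⟩
        dsimp only
        rw [Preadditive.sum_comp]
        simp only [Category.assoc, biproduct.ι_desc]
        rw [hβ ⟨s, hs⟩, (b s).sum_repr]
      · have hφ : φ = 0 := by
          by_contra h
          exact hs ⟨φ, h⟩
        exact ⟨0, by simp [hφ]⟩
  let e := Fintype.equivFin ι
  let r : Fin (Fintype.card ι) → ℤ := fun l => (e.symm l).1.1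
  let w : (⨁ fun l => E⟦r l⟧) ≅ ⨁ F := biproduct.reindex e.symm F
  refine ⟨Fintype.card ι, r, w.hom ≫ biproduct.desc β, fun s => ?_⟩
  have hw : Function.Bijective (fun g : E⟦s⟧ ⟶ ⨁ fun l => E⟦r l⟧ => g ≫ w.hom) :=
    (w.homToEquiv (Z := E⟦s⟧)).bijective
  convert (hbij s).comp hw using 2
  simp

end Exceptional

/-- an exceptional collection `E 0, …, E (n-1)` in a `k`-linear pretriangulated
category (with suitable finiteness of `Hom(E j, X⟦i⟧)`) induces a semiorthogonal
decomposition `T = ⟨E₁^⊥ ∩ ⋯ ∩ E_n^⊥, E₁, …, E_n⟩`: every object `X` admits a chain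
`X = Y 0, Y 1, …, Y n` of objects with distinguished triangles
`B_i → Y (i-1) → Y i → B_i⟦1⟧` where `B_i` is a finite biproduct of shifts of the
`(n+1-i)`-th member of the collection (`E i.rev` in 0-based indexing), and the last
object `Y n` is right orthogonal to all the `E j`. -/
theorem statement8 {k : Type*} [Field k] {C : Type*} [Category C] [Preadditive C]
    [Linear k C] [HasZeroObject C] [HasShift C ℤ]
    [∀ m : ℤ, (shiftFunctor C m).Additive] [Pretriangulated C]
    (n : ℕ) (E : Fin n → C)
    (hexc1 : ∀ j, Function.Bijective (fun a : k => a • (𝟙 (E j))))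
    (hexc2 : ∀ j, ∀ t : ℤ, t ≠ 0 → ∀ f : E j ⟶ (E j)⟦t⟧, f = 0)
    (hcoll : ∀ i j : Fin n, j < i → ∀ t : ℤ, ∀ f : E i ⟶ (E j)⟦t⟧, f = 0)
    (hfin : ∀ (j : Fin n) (X : C) (i : ℤ), FiniteDimensional k (E j ⟶ X⟦i⟧))
    (hvan : ∀ (j : Fin n) (X : C), Set.Finite {i : ℤ | ∃ f : E j ⟶ X⟦i⟧, f ≠ 0}) :
    ∀ X : C, ∃ Y : Fin (n + 1) → C, Y 0 = X ∧
      (∀ i : Fin n, ∃ (Bi : C) (f : Bi ⟶ Y i.castSucc) (g : Y i.castSucc ⟶ Y i.succ)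
        (h : Y i.succ ⟶ Bi⟦(1 : ℤ)⟧),
        (Triangle.mk f g h ∈ distTriang C) ∧
        ∃ (m : ℕ) (s : Fin m → ℤ), Nonempty (Bi ≅ ⨁ (fun l : Fin m => ((E i.rev)⟦s l⟧)))) ∧
      (∀ (j : Fin n) (t : ℤ) (f : E j ⟶ (Y (Fin.last n))⟦t⟧), f = 0) := by
  have hstep : ∀ (j : Fin n) (X : C), ∃ Y : C,
      (∃ (B : C) (f : B ⟶ X) (g : X ⟶ Y) (h : Y ⟶ B⟦(1 : ℤ)⟧),
        (Triangle.mk f g h ∈ distTriang C) ∧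
        ∃ (m : ℕ) (s : Fin m → ℤ), Nonempty (B ≅ ⨁ (fun l : Fin m => ((E j)⟦s l⟧)))) ∧
      ShiftOrthogonal (E j) Y ∧
      ∀ i, j < i → ShiftOrthogonal (E i) X → ShiftOrthogonal (E i) Y := by
    intro j X
    obtain ⟨m, r, f, hf⟩ := exists_exceptional_approximation (E j) X (hexc1 j) (hexc2 j)
      (hfin j X) (hvan j X)
    obtain ⟨Y, g, h, hT⟩ := distinguished_cocone_triangle f
    refine ⟨Y, ⟨_, f, g, h, hT, m, r, ⟨Iso.refl _⟩⟩, ?_, fun i hi hX => ?_⟩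
    · refine shiftOrthogonal_obj₃ hT (fun s φ => ?_) fun s φ hφ => ?_
      · obtain ⟨ψ, hψ⟩ := (hf s).2 φ
        exact ⟨ψ, hψ.symm⟩
      · exact (hf s).1 (hφ.trans zero_comp.symm)
    · have hB : ShiftOrthogonal (E i) (⨁ fun l => (E j)⟦r l⟧) :=
        ShiftOrthogonal.biproduct fun l s => eq_zero_of_shift_hom_shift (hcoll i j hi _)
      exact shiftOrthogonal_obj₃ hT (fun s φ => ⟨0, by rw [zero_comp]; exact hX s φ⟩)
        fun s φ _ => hB s φ
  choose N hN hN₁ hN₂ using hstep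
  intro X
  let Y : Fin (n + 1) → C := Fin.induction X fun i Z => N i.rev Z
  have hY (i : Fin n) : Y i.succ = N i.rev (Y i.castSucc) := Fin.induction_succ _ _ i
  have horth (i : Fin (n + 1)) : ∀ j : Fin n, n ≤ j + i → ShiftOrthogonal (E j) (Y i) := by
    induction i using Fin.induction with
    | zero => intro j hj; simp at hj; lia
    | succ i ih =>
      intro j hj
      rw [hY]
      by_cases hji : j = i.rev
      · subst hji
        exact hN₁ _ _
      · have hne : (j : ℕ) ≠ i.rev := fun h => hji (Fin.ext h)
        rw [Fin.val_rev] at hne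
        rw [Fin.val_succ] at hj
        refine hN₂ _ _ j ?_ (ih j ?_)
        · rw [Fin.lt_def, Fin.val_rev]
          lia
        · rw [Fin.val_castSucc]
          lia
  refine ⟨Y, rfl, fun i => ?_, fun j => (horth _ j (by simp)).eq_zero⟩
  rw [hY]
  exact hN _ _
end
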